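/- There exist absolute constants B > 0 and C > 0 such that the following holds. Let k ≥ 1, let 𝓗 = {h₁, …, h_k} be an admissible set of k distinct natural numbers (admissible meaning ν_𝓗(p) < p for every prime p), set D_𝓗 := ∏_{1 ≤ i < j ≤ k} (h_i − h_j) and L := k·log log(3|D_𝓗|), and set W(z) := ∏_{p < z, p prime} (1 − ν_𝓗(p)/p). If z ≥ 2 satisfies L ≤ (1/B)·log z and k² ≤ (1/B)·log z, then |W(z) − 𝔖(𝓗)·e^{−γk}/(log z)^k| ≤ C·𝔖(𝓗)·e^{−γk}·(log z)^{−k}·(L + k³)/log z, where γ is the Euler–Mascheroni constant. -/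

import Mathlib

open scoped BigOperators

/-- Number of residue classes modulo `p` occupied by the elements of `H`. -/
noncomputable def nuH (H : Finset ℤ) (p : ℕ) : ℕ :=
  (H.image (fun x => x % (p : ℤ))).card

/-- A set is admissible if it does not cover all residue classes modulo any prime. -/
def Admissible (H : Finset ℤ) : Prop := ∀ p : ℕ, p.Prime → nuH H p < p

/-- The multiplicative extension of `ν_𝓗` to squarefree `d`. -/
noncomputable def nuMult (H : Finset ℤ) (d : ℕ) : ℕ := ∏ p ∈ d.primeFactors, nuH H p

/-- The Selberg sieve density function `g(d) = ν(d)/(d ∏_{p ∣ d}(1 - ν(p)/p))`. -/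
noncomputable def gSel (H : Finset ℤ) (d : ℕ) : ℝ :=
  (nuMult H d : ℝ) / ((d : ℝ) * ∏ p ∈ d.primeFactors, (1 - (nuH H p : ℝ) / p))

/-- `G(z) = ∑_{d < z} μ(d)² g(d)`. -/
noncomputable def GSel (H : Finset ℤ) (z : ℝ) : ℝ :=
  ∑ d ∈ Finset.Ico 1 ⌈z⌉₊, ((ArithmeticFunction.moebius d : ℤ) : ℝ) ^ 2 * gSel H d

/-- `W(z) = ∏_{p < z} (1 - ν(p)/p)`. -/
noncomputable def WSel (H : Finset ℤ) (z : ℝ) : ℝ :=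
  ∏ p ∈ (Finset.range ⌈z⌉₊).filter Nat.Prime, (1 - (nuH H p : ℝ) / p)

/-- The singular series of a finite set of integers. -/
noncomputable def singSeries (H : Finset ℤ) : ℝ :=
  ∏' p : Nat.Primes,
    (1 - (nuH H (p : ℕ) : ℝ) / ((p : ℕ) : ℝ)) / (1 - 1 / ((p : ℕ) : ℝ)) ^ H.card

section

open Finset Filter Topology

theorem log_factorial_eq_sum_primes (n : ℕ) :
    Real.log (n.factorial : ℝ) =
      ∑ p ∈ n.primesLE, (n.factorial.factorization p : ℝ) * Real.log p := by
  rw [Real.log_nat_eq_sum_factorization, Finsupp.sum]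
  refine Finset.sum_subset ?_ ?_
  · intro p hp
    have hp' := Nat.prime_of_mem_primeFactors (n := n.factorial) (by simpa using hp)
    have hd := Nat.dvd_of_mem_primeFactors (n := n.factorial) (by simpa using hp)
    rw [Nat.mem_primesLE]
    exact ⟨(hp'.dvd_factorial).1 hd, hp'⟩
  · intro p _ hp
    rw [Finsupp.notMem_support_iff.1 hp]; simp

theorem factorization_factorial_bounds {p : ℕ} (hp : p.Prime) {n : ℕ} (hpn : p ≤ n) :
    (n : ℝ) / p - 1 ≤ n.factorial.factorization p ∧
      (n.factorial.factorization p : ℝ) ≤ n / (p - 1) := by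
  have hp1 : (1 : ℝ) < p := by exact_mod_cast hp.one_lt
  constructor
  · have h1 : n / p ≤ n.factorial.factorization p := by
      rw [Nat.factorization_factorial hp (Nat.lt_succ_self _)]
      have hmem : 1 ∈ Finset.Ico 1 (Nat.log p n).succ := by
        have := Nat.log_pos hp.one_lt hpn
        rw [Finset.mem_Ico]; omega
      simpa using Finset.single_le_sum (f := fun i => n / p ^ i) (fun _ _ => Nat.zero_le _) hmem
    have h2 : (n : ℝ) / p < (n / p : ℕ) + 1 := by
      rw [← Nat.floor_div_eq_div (K := ℝ)]
      exact Nat.lt_floor_add_one _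
    have h3 : ((n / p : ℕ) : ℝ) ≤ n.factorial.factorization p := by exact_mod_cast h1
    linarith
  · have : Fact p.Prime := ⟨hp⟩
    have h := sub_one_mul_padicValNat_factorial (p := p) n
    rw [le_div_iff₀ (by linarith)]
    rw [Nat.factorization_def _ hp]
    have h' : (p - 1) * padicValNat p n.factorial ≤ n := by rw [h]; exact Nat.sub_le _ _
    have h'' : ((p : ℝ) - 1) * padicValNat p n.factorial ≤ n := by
      rw [← Nat.cast_one, ← Nat.cast_sub hp.one_le]; exact_mod_cast h'
    linarith

theorem exists_sum_primes_log_div_mul_sub_one_le :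
    ∃ K : ℝ, ∀ n : ℕ, ∑ p ∈ n.primesLE, Real.log p / (p * ((p : ℝ) - 1)) ≤ K := by
  have hs : Summable (fun n : ℕ => 4 * (1 / (n : ℝ) ^ (3 / 2 : ℝ))) :=
    (Real.summable_one_div_nat_rpow.2 (by norm_num)).mul_left 4
  refine ⟨∑' n : ℕ, 4 * (1 / (n : ℝ) ^ (3 / 2 : ℝ)), fun n => ?_⟩
  refine le_trans (Finset.sum_le_sum fun p hp => ?_)
    (hs.sum_le_tsum n.primesLE (fun i _ => by positivity))
  have hp2 : (2 : ℝ) ≤ p := by exact_mod_cast (Nat.mem_primesLE.1 hp).2.two_le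
  have hlog : Real.log p ≤ (p : ℝ) ^ (1 / 2 : ℝ) / (1 / 2) :=
    Real.log_le_rpow_div (by linarith) (by norm_num)
  have hsplit : (p : ℝ) ^ (3 / 2 : ℝ) * (p : ℝ) ^ (1 / 2 : ℝ) = p * p := by
    rw [← Real.rpow_add (by linarith)]; norm_num; ring
  have hpos : 0 < (p : ℝ) ^ (3 / 2 : ℝ) := by positivity
  rw [mul_one_div, div_le_div_iff₀ (by nlinarith) hpos]
  calc Real.log p * (p : ℝ) ^ (3 / 2 : ℝ)
      ≤ ((p : ℝ) ^ (1 / 2 : ℝ) / (1 / 2)) * (p : ℝ) ^ (3 / 2 : ℝ) := by gcongr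
    _ = 2 * (p * p) := by rw [← hsplit]; ring
    _ ≤ 4 * (p * ((p : ℝ) - 1)) := by nlinarith

/-- Mertens' first theorem. -/
theorem exists_abs_sum_primes_log_div_sub_log_le :
    ∃ K : ℝ, ∀ n : ℕ, 1 ≤ n → |∑ p ∈ n.primesLE, Real.log p / p - Real.log n| ≤ K := by
  obtain ⟨K, hK⟩ := exists_sum_primes_log_div_mul_sub_one_le
  refine ⟨max (Real.log 4) (1 + K), fun n hn => ?_⟩
  have hn0 : (0 : ℝ) < n := by exact_mod_cast hn
  have hfac := log_factorial_eq_sum_primes n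
  have hup : Real.log (n.factorial : ℝ) ≤ n * Real.log n := by
    rw [← Real.log_pow]
    exact Real.log_le_log (by exact_mod_cast n.factorial_pos) (by exact_mod_cast n.factorial_le_pow)
  have hlow : n * Real.log n - n ≤ Real.log (n.factorial : ℝ) := by
    have h := Stirling.le_log_factorial_stirling (n := n) (by omega)
    have h1 : 0 ≤ Real.log (n : ℝ) := Real.log_natCast_nonneg n
    have h2 : 0 ≤ Real.log (2 * Real.pi) := Real.log_nonneg (by linarith [Real.pi_gt_three])
    linarith
  have htheta : ∑ p ∈ n.primesLE, Real.log p ≤ Real.log 4 * n := by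
    rw [← Chebyshev.theta_eq_sum_primesLE_log]
    exact Chebyshev.theta_le_log4_mul_x hn0.le
  have hA : n * ∑ p ∈ n.primesLE, Real.log p / p - ∑ p ∈ n.primesLE, Real.log p
      ≤ Real.log (n.factorial : ℝ) := by
    rw [hfac, Finset.mul_sum, ← Finset.sum_sub_distrib]
    refine Finset.sum_le_sum fun p hp => ?_
    obtain ⟨hpn, hp⟩ := Nat.mem_primesLE.1 hp
    have h := mul_le_mul_of_nonneg_right (factorization_factorial_bounds hp hpn).1
      (Real.log_natCast_nonneg p)
    calc _ = ((n : ℝ) / p - 1) * Real.log p := by ring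
      _ ≤ _ := h
  have hB : Real.log (n.factorial : ℝ) ≤ n * ∑ p ∈ n.primesLE, Real.log p / p +
      n * ∑ p ∈ n.primesLE, Real.log p / (p * ((p : ℝ) - 1)) := by
    rw [hfac, Finset.mul_sum, Finset.mul_sum, ← Finset.sum_add_distrib]
    refine Finset.sum_le_sum fun p hp => ?_
    obtain ⟨hpn, hp⟩ := Nat.mem_primesLE.1 hp
    have h := mul_le_mul_of_nonneg_right (factorization_factorial_bounds hp hpn).2
      (Real.log_natCast_nonneg p)
    have hp1 : (1 : ℝ) < p := by exact_mod_cast hp.one_lt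
    have h0 : (p : ℝ) - 1 ≠ 0 := by linarith
    refine h.trans (le_of_eq ?_)
    field_simp
    ring
  have hKn := hK n
  rw [abs_le]
  constructor
  · have h1 : -(1 + K) ≤ ∑ p ∈ n.primesLE, Real.log p / p - Real.log n := by
      have : n * (Real.log n - 1) ≤ n * (∑ p ∈ n.primesLE, Real.log p / p + K) := by
        nlinarith
      have := le_of_mul_le_mul_left this hn0
      linarith
    linarith [le_max_right (Real.log 4) (1 + K)]
  · have : n * ∑ p ∈ n.primesLE, Real.log p / p ≤ n * (Real.log n + Real.log 4) := by
      linarith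
    have := le_of_mul_le_mul_left this hn0
    linarith [le_max_left (Real.log 4) (1 + K)]

theorem abs_log_one_sub_add_le {x : ℝ} (h0 : 0 ≤ x) (h : x ≤ 1 / 2) :
    |Real.log (1 - x) + x| ≤ 2 * x ^ 2 := by
  have hx : |x| < 1 := by rw [abs_of_nonneg h0]; linarith
  have h1 := Real.abs_log_sub_add_sum_range_le hx 1
  rw [abs_of_nonneg h0] at h1
  simp only [Finset.sum_range_one, zero_add, pow_one, Nat.cast_zero, div_one,
    one_add_one_eq_two] at h1
  rw [add_comm]
  refine h1.trans ?_
  rw [div_le_iff₀ (by linarith)]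
  nlinarith [mul_nonneg (sq_nonneg x) (by linarith : (0 : ℝ) ≤ 1 - 2 * x)]

theorem abs_sum_Ico_mul_le_of_antitone {w u : ℕ → ℝ} {K : ℝ} {m n : ℕ} (hmn : m ≤ n)
    (hw0 : ∀ i, m ≤ i → 0 ≤ w i) (hw : ∀ i, m ≤ i → w (i + 1) ≤ w i)
    (hu : ∀ i, m ≤ i → |∑ j ∈ Ico m i, u j| ≤ K) :
    |∑ i ∈ Ico m n, w i * u i| ≤ K * w m := by
  have hid : ∀ n, m ≤ n → ∑ i ∈ Ico m n, w i * u i = w n * ∑ j ∈ Ico m n, u j +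
      ∑ i ∈ Ico m n, (w i - w (i + 1)) * ∑ j ∈ Ico m (i + 1), u j := by
    intro n hn
    induction n, hn using Nat.le_induction with
    | base => simp
    | succ n hn ih =>
      rw [Finset.sum_Ico_succ_top hn, ih, Finset.sum_Ico_succ_top hn (fun i => _ * _),
        Finset.sum_Ico_succ_top hn u]
      ring
  have htel : ∀ n, m ≤ n → ∑ i ∈ Ico m n, (w i - w (i + 1)) = w m - w n := by
    intro n hn
    induction n, hn using Nat.le_induction with
    | base => simp
    | succ n hn ih => rw [Finset.sum_Ico_succ_top hn, ih]; ring
  rw [hid n hmn]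
  calc _ ≤ |w n * ∑ j ∈ Ico m n, u j| +
        |∑ i ∈ Ico m n, (w i - w (i + 1)) * ∑ j ∈ Ico m (i + 1), u j| := abs_add_le _ _
    _ ≤ w n * K + ∑ i ∈ Ico m n, (w i - w (i + 1)) * K := by
        gcongr
        · rw [abs_mul, abs_of_nonneg (hw0 n hmn)]
          exact mul_le_mul_of_nonneg_left (hu n hmn) (hw0 n hmn)
        · refine (Finset.abs_sum_le_sum_abs _ _).trans (Finset.sum_le_sum fun i hi => ?_)
          have hi := (Finset.mem_Ico.1 hi).1
          have h0 := sub_nonneg.2 (hw i hi)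
          rw [abs_mul, abs_of_nonneg h0]
          exact mul_le_mul_of_nonneg_left (hu _ (by omega)) h0
    _ = K * w m := by rw [← Finset.sum_mul, htel n hmn]; ring

theorem sum_Ico_inv_sq_le {m : ℕ} (hm : 1 ≤ m) (n : ℕ) :
    ∑ i ∈ Ico m n, ((i : ℝ) ^ 2)⁻¹ ≤ 2 / m := by
  have h := sum_Ioo_inv_sq_le (α := ℝ) (m - 1) n
  have e : Ioo (m - 1) n = Ico m n := by
    ext i; simp only [Finset.mem_Ioo, Finset.mem_Ico]; omega
  rw [e] at h
  have : (((m - 1 : ℕ) : ℝ) + 1) = m := by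
    rw [Nat.cast_sub hm]; simp
  rwa [this] at h

theorem log_succ_sub_log_le {n : ℕ} (hn : 1 ≤ n) :
    Real.log ((n + 1 : ℕ) : ℝ) - Real.log n ≤ 1 / n := by
  have hn0 : (0 : ℝ) < n := by exact_mod_cast hn
  rw [← Real.log_div (by positivity) hn0.ne']
  have h := Real.log_le_sub_one_of_pos (x := ((n + 1 : ℕ) : ℝ) / n) (by positivity)
  refine h.trans (le_of_eq ?_)
  push_cast
  field_simp
  ring

theorem log_le_log_succ (n : ℕ) : Real.log (n : ℝ) ≤ Real.log ((n + 1 : ℕ) : ℝ) := by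
  rcases Nat.eq_zero_or_pos n with rfl | h
  · simp
  · exact Real.log_le_log (by exact_mod_cast h) (by push_cast; linarith)

theorem one_le_log_natCast {n : ℕ} (hn : 3 ≤ n) : 1 ≤ Real.log (n : ℝ) := by
  rw [Real.le_log_iff_exp_le (by positivity)]
  have : (3 : ℝ) ≤ n := by exact_mod_cast hn
  linarith [Real.exp_one_lt_d9]

theorem log_le_self_natCast (n : ℕ) : Real.log (n : ℝ) ≤ n :=
  Real.log_le_self (Nat.cast_nonneg n)

/-- The logarithmic weight of a prime in Mertens' product, extended by zero. -/
noncomputable def mertensWeight (n : ℕ) : ℝ :=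
  if n.Prime then -Real.log (1 - 1 / (n : ℝ)) else 0

theorem abs_mertensWeight_step_le {n : ℕ} (hn : 3 ≤ n) :
    |mertensWeight n - (Real.log (Real.log ((n + 1 : ℕ) : ℝ)) - Real.log (Real.log n)) -
      (Real.log n)⁻¹ * ((if n.Prime then Real.log n / n else 0) -
        (Real.log ((n + 1 : ℕ) : ℝ) - Real.log n))| ≤ 3 * ((n : ℝ) ^ 2)⁻¹ := by
  have hl := one_le_log_natCast hn
  have hl' := log_le_log_succ n
  have hn3 : (3 : ℝ) ≤ n := by exact_mod_cast hn
  have hn0 : (0 : ℝ) < n := by linarith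
  set δ := (Real.log n)⁻¹ * (Real.log ((n + 1 : ℕ) : ℝ) - Real.log n) with hδ
  have hδ0 : 0 ≤ δ := mul_nonneg (by positivity) (by linarith)
  have hδ1 : δ ≤ 1 / n := by
    have h1 := log_succ_sub_log_le (n := n) (by omega)
    have h2 : (Real.log n)⁻¹ ≤ 1 := inv_le_one_of_one_le₀ hl
    calc δ ≤ 1 * (1 / n) := by
          rw [hδ]; exact mul_le_mul h2 h1 (by linarith) (by norm_num)
      _ = _ := one_mul _
  have hll : Real.log (Real.log ((n + 1 : ℕ) : ℝ)) - Real.log (Real.log n) =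
      Real.log (1 + δ) := by
    rw [← Real.log_div (by linarith) (by linarith), hδ]
    congr 1
    field_simp
    ring
  have hd1 : Real.log (1 + δ) ≤ δ := by
    have := Real.log_le_sub_one_of_pos (x := 1 + δ) (by linarith); linarith
  have hd2 : δ - δ ^ 2 ≤ Real.log (1 + δ) := by
    have h := Real.one_sub_inv_le_log_of_pos (x := 1 + δ) (by linarith)
    have : δ - δ ^ 2 ≤ 1 - (1 + δ)⁻¹ := by
      have e : 1 - (1 + δ)⁻¹ = δ / (1 + δ) := by field_simp; ring
      rw [e, le_div_iff₀ (by linarith)]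
      nlinarith [pow_nonneg hδ0 3]
    linarith
  have hsq : δ ^ 2 ≤ ((n : ℝ) ^ 2)⁻¹ := by
    calc δ ^ 2 ≤ (1 / (n : ℝ)) ^ 2 := by gcongr
      _ = _ := by rw [one_div, inv_pow]
  have hp : |mertensWeight n - (Real.log n)⁻¹ * (if n.Prime then Real.log n / n else 0)| ≤
      2 * ((n : ℝ) ^ 2)⁻¹ := by
    unfold mertensWeight
    split_ifs with h
    · have h1 := abs_log_one_sub_add_le (x := 1 / (n : ℝ)) (by positivity)
        (by rw [div_le_div_iff₀ hn0 (by norm_num)]; linarith)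
      rw [← abs_neg]
      convert! h1 using 2
      · field_simp; ring
      · rw [one_div, inv_pow]
    · simp
  rw [hll]
  have e : ∀ a b c : ℝ, a - c - (Real.log n)⁻¹ * (b - (Real.log ((n + 1 : ℕ) : ℝ) - Real.log n))
      = (a - (Real.log n)⁻¹ * b) + (δ - c) := by
    intro a b c; rw [hδ]; ring
  rw [e]
  have h2 : |δ - Real.log (1 + δ)| ≤ ((n : ℝ) ^ 2)⁻¹ := by
    rw [abs_le]; constructor <;> nlinarith
  exact (abs_add_le _ _).trans (by linarith)

theorem sum_primesLE_eq_sum_range (g : ℕ → ℝ) (n : ℕ) :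
    ∑ p ∈ n.primesLE, g p = ∑ i ∈ range (n + 1), if i.Prime then g i else 0 := by
  rw [← Finset.sum_filter]
  refine Finset.sum_congr ?_ fun _ _ => rfl
  ext p
  simp [Nat.mem_primesLE]

theorem exists_abs_mertensWeight_sum_Ico_sub_le :
    ∃ K : ℝ, 0 ≤ K ∧ ∀ m n : ℕ, 3 ≤ m → m ≤ n →
      |(∑ i ∈ range n, mertensWeight i - Real.log (Real.log n)) -
        (∑ i ∈ range m, mertensWeight i - Real.log (Real.log m))| ≤ K / Real.log m := by
  obtain ⟨K, hK⟩ := exists_abs_sum_primes_log_div_sub_log_le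
  have hK0 : 0 ≤ K := (abs_nonneg _).trans (hK 1 le_rfl)
  set u : ℕ → ℝ := fun i => (if i.Prime then Real.log i / i else 0) -
    (Real.log ((i + 1 : ℕ) : ℝ) - Real.log i) with hu
  have hsum : ∀ n : ℕ, ∑ i ∈ range n, u i =
      (∑ i ∈ range n, if i.Prime then Real.log i / i else 0) - Real.log n := by
    intro n
    rw [hu, Finset.sum_sub_distrib, Finset.sum_range_sub (fun i : ℕ => Real.log (i : ℝ))]
    simp
  have hb : ∀ n : ℕ, 2 ≤ n → |∑ i ∈ range n, u i| ≤ K + 1 := by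
    intro n hn
    obtain ⟨j, rfl⟩ : ∃ j, n = j + 1 := ⟨n - 1, by omega⟩
    have h := hK j (by omega)
    rw [sum_primesLE_eq_sum_range] at h
    rw [hsum]
    have h1 := log_succ_sub_log_le (n := j) (by omega)
    have h2 := log_le_log_succ j
    have h3 : (1 : ℝ) / j ≤ 1 := by
      rw [div_le_one (by exact_mod_cast (by omega : 0 < j))]; exact_mod_cast (by omega : 1 ≤ j)
    rw [abs_le] at h ⊢
    constructor <;> linarith
  refine ⟨2 * (K + 1) + 6, by linarith, fun m n hm hmn => ?_⟩
  have hlm := one_le_log_natCast hm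
  have hrepr : (∑ i ∈ range n, mertensWeight i - Real.log (Real.log n)) -
        (∑ i ∈ range m, mertensWeight i - Real.log (Real.log m)) =
      ∑ i ∈ Ico m n, (Real.log i)⁻¹ * u i + ∑ i ∈ Ico m n, (mertensWeight i -
        (Real.log (Real.log ((i + 1 : ℕ) : ℝ)) - Real.log (Real.log i)) -
          (Real.log i)⁻¹ * u i) := by
    rw [← Finset.sum_add_distrib]
    simp only [add_sub_cancel]
    rw [Finset.sum_sub_distrib, Finset.sum_Ico_eq_sub _ hmn, Finset.sum_Ico_eq_sub _ hmn,
      Finset.sum_range_sub (fun i : ℕ => Real.log (Real.log (i : ℝ))),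
      Finset.sum_range_sub (fun i : ℕ => Real.log (Real.log (i : ℝ)))]
    ring
  rw [hrepr]
  have h1 : |∑ i ∈ Ico m n, (Real.log i)⁻¹ * u i| ≤ (2 * (K + 1)) * (Real.log m)⁻¹ := by
    refine abs_sum_Ico_mul_le_of_antitone (w := fun i : ℕ => (Real.log (i : ℝ))⁻¹) hmn ?_ ?_ ?_
    · intro i _; exact inv_nonneg.2 (Real.log_natCast_nonneg i)
    · intro i hi
      have := one_le_log_natCast (hm.trans hi)
      exact inv_anti₀ (by linarith) (log_le_log_succ i)
    · intro i hi
      rw [Finset.sum_Ico_eq_sub _ hi]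
      have h1 := hb i (by omega)
      have h2 := hb m (by omega)
      rw [abs_le] at h1 h2 ⊢
      constructor <;> linarith
  have h2 : |∑ i ∈ Ico m n, (mertensWeight i -
        (Real.log (Real.log ((i + 1 : ℕ) : ℝ)) - Real.log (Real.log i)) -
          (Real.log i)⁻¹ * u i)| ≤ 6 * (Real.log m)⁻¹ := by
    refine (Finset.abs_sum_le_sum_abs _ _).trans ?_
    calc _ ≤ ∑ i ∈ Ico m n, 3 * ((i : ℝ) ^ 2)⁻¹ := Finset.sum_le_sum fun i hi =>
          abs_mertensWeight_step_le (hm.trans (Finset.mem_Ico.1 hi).1)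
      _ ≤ 3 * (2 / m) := by
          rw [← Finset.mul_sum]
          exact mul_le_mul_of_nonneg_left (sum_Ico_inv_sq_le (by omega) n) (by norm_num)
      _ = 6 * (m : ℝ)⁻¹ := by ring
      _ ≤ _ := by
          gcongr
          exact log_le_self_natCast m
  calc _ ≤ _ := abs_add_le _ _
    _ ≤ (2 * (K + 1)) * (Real.log m)⁻¹ + 6 * (Real.log m)⁻¹ := add_le_add h1 h2
    _ = _ := by ring

/-- Mertens' second theorem, with an unspecified constant. -/
theorem exists_mertens_constant :
    ∃ c K : ℝ, 0 ≤ K ∧ ∀ n : ℕ, 3 ≤ n →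
      |∑ i ∈ range n, mertensWeight i - Real.log (Real.log n) - c| ≤ K / Real.log n := by
  obtain ⟨K, hK0, hK⟩ := exists_abs_mertensWeight_sum_Ico_sub_le
  set E : ℕ → ℝ := fun n => ∑ i ∈ range n, mertensWeight i - Real.log (Real.log n) with hE
  have hlim : Filter.Tendsto (fun n : ℕ => K / Real.log (n : ℝ)) Filter.atTop (nhds 0) :=
    (Real.tendsto_log_atTop.comp tendsto_natCast_atTop_atTop).const_div_atTop K
  have hc : CauchySeq E := by
    rw [Metric.cauchySeq_iff']
    intro ε hε
    obtain ⟨N, hN⟩ := Filter.eventually_atTop.1 (hlim.eventually (gt_mem_nhds hε))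
    refine ⟨max N 3, fun n hn => ?_⟩
    rw [Real.dist_eq]
    exact (hK _ n (le_max_right _ _) hn).trans_lt (hN _ (le_max_left _ _))
  obtain ⟨c, hc⟩ := cauchySeq_tendsto_of_complete hc
  refine ⟨c, K, hK0, fun n hn => ?_⟩
  have h1 : Filter.Tendsto (fun j => |E j - E n|) Filter.atTop (nhds |c - E n|) :=
    (hc.sub_const _).abs
  have h2 := le_of_tendsto h1 (Filter.eventually_atTop.2 ⟨n, fun j hj => hK n j hn hj⟩)
  rw [abs_sub_comm]
  exact h2

/-- The `n`-th term of the logarithm of the Euler product for `ζ(s)`. -/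
noncomputable def logEulerTerm (s : ℝ) (n : ℕ) : ℝ :=
  if n.Prime then -Real.log (1 - (n : ℝ) ^ (-s)) else 0

theorem logEulerTerm_one : logEulerTerm 1 = mertensWeight := by
  ext n
  simp [logEulerTerm, mertensWeight, Real.rpow_neg_one]

theorem rpow_neg_le_inv {s : ℝ} (hs : 1 ≤ s) {n : ℕ} (hn : 1 ≤ n) :
    (n : ℝ) ^ (-s) ≤ (n : ℝ)⁻¹ := by
  rw [← Real.rpow_neg_one]
  exact Real.rpow_le_rpow_of_exponent_le (by exact_mod_cast hn) (by linarith)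

theorem Nat.Prime.cast_inv_le_half {p : ℕ} (hp : p.Prime) : (p : ℝ)⁻¹ ≤ 1 / 2 := by
  rw [one_div]
  exact inv_anti₀ (by norm_num) (by exact_mod_cast hp.two_le)

theorem abs_logEulerTerm_sub_le {s : ℝ} (hs : 1 ≤ s) (n : ℕ) :
    |logEulerTerm s n - if n.Prime then (n : ℝ) ^ (-s) else 0| ≤ 2 * ((n : ℝ) ^ 2)⁻¹ := by
  unfold logEulerTerm
  split_ifs with h
  · have h0 : 0 ≤ (n : ℝ) ^ (-s) := by positivity
    have h1 := rpow_neg_le_inv hs h.one_le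
    have h2 := abs_log_one_sub_add_le h0 (h1.trans h.cast_inv_le_half)
    rw [← abs_neg]
    calc _ = |Real.log (1 - (n : ℝ) ^ (-s)) + (n : ℝ) ^ (-s)| := by congr 1; ring
      _ ≤ _ := h2
      _ ≤ 2 * ((n : ℝ)⁻¹) ^ 2 := by gcongr
      _ = _ := by rw [inv_pow]
  · simp

theorem logEulerTerm_nonneg {s : ℝ} (hs : 1 ≤ s) (n : ℕ) : 0 ≤ logEulerTerm s n := by
  unfold logEulerTerm
  split_ifs with h
  · have h0 : 0 ≤ (n : ℝ) ^ (-s) := by positivity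
    have h1 := (rpow_neg_le_inv hs h.one_le).trans h.cast_inv_le_half
    have := Real.log_nonpos (x := 1 - (n : ℝ) ^ (-s)) (by linarith) (by linarith)
    linarith
  · exact le_rfl

theorem mertensWeight_nonneg (n : ℕ) : 0 ≤ mertensWeight n := by
  rw [← logEulerTerm_one]; exact logEulerTerm_nonneg le_rfl n

theorem summable_inv_sq : Summable fun n : ℕ => ((n : ℝ) ^ 2)⁻¹ :=
  Real.summable_nat_pow_inv.2 (by norm_num)

theorem summable_prime_rpow {s : ℝ} (hs : 1 < s) :
    Summable fun n : ℕ => if n.Prime then (n : ℝ) ^ (-s) else 0 := by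
  refine Summable.of_nonneg_of_le (fun n => ?_) (fun n => ?_)
    (Real.summable_nat_rpow.2 (by linarith : -s < -1))
  · split_ifs <;> positivity
  · split_ifs
    · exact le_rfl
    · positivity

theorem summable_logEulerTerm {s : ℝ} (hs : 1 < s) : Summable (logEulerTerm s) := by
  have h1 : Summable fun n : ℕ => logEulerTerm s n - if n.Prime then (n : ℝ) ^ (-s) else 0 :=
    Summable.of_norm_bounded (summable_inv_sq.mul_left 2) (abs_logEulerTerm_sub_le hs.le)
  simpa using h1.add (summable_prime_rpow hs)

theorem exp_tsum_logEulerTerm {s : ℝ} (hs : 1 < s) :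
    Real.exp (∑' n, logEulerTerm s n) = ∑' n : ℕ, 1 / (n : ℝ) ^ s := by
  let f : ℕ →*₀ ℝ :=
    { toFun := fun n => (n : ℝ) ^ (-s)
      map_zero' := by simp [Real.zero_rpow (by linarith : -s ≠ 0)]
      map_one' := by simp
      map_mul' := fun m n => by
        push_cast
        exact Real.mul_rpow (Nat.cast_nonneg m) (Nat.cast_nonneg n) }
  have hf : ∀ n : ℕ, f n = (n : ℝ) ^ (-s) := fun _ => rfl
  have hfs : Summable fun n => ‖f n‖ :=
    (Real.summable_nat_rpow.2 (by linarith : -s < -1)).norm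
  have hprod := (EulerProduct.eulerProduct_completely_multiplicative_hasProd hfs).tprod_eq
  have hsub : ∑' n, logEulerTerm s n = ∑' p : Nat.Primes, Real.log ((1 - f p)⁻¹) := by
    have h1 : ∀ p : Nat.Primes, Real.log ((1 - f p)⁻¹) = logEulerTerm s p := by
      intro p
      rw [Real.log_inv, logEulerTerm, if_pos p.2, hf]
    simp_rw [h1]
    refine (tsum_subtype_eq_of_support_subset (s := {p : ℕ | p.Prime}) ?_).symm
    intro n hn
    by_contra h
    exact hn (if_neg h)
  have hsum : Summable fun p : Nat.Primes => Real.log ((1 - f p)⁻¹) := by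
    refine ((summable_logEulerTerm hs).subtype {p : ℕ | p.Prime}).congr fun p => ?_
    rw [Real.log_inv, hf]
    exact if_pos p.2
  rw [hsub, Real.rexp_tsum_eq_tprod (fun p => ?_) hsum, hprod]
  · refine tsum_congr fun n => ?_
    rw [hf, Real.rpow_neg (Nat.cast_nonneg n), one_div]
  · have h1 := (rpow_neg_le_inv hs.le p.2.one_le).trans p.2.cast_inv_le_half
    rw [hf]
    exact inv_pos.2 (by linarith)

theorem tendsto_one_add_nhdsGT : Tendsto (fun σ : ℝ => 1 + σ) (𝓝[>] 0) (𝓝[>] 1) := by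
  refine tendsto_nhdsWithin_iff.2 ⟨?_, ?_⟩
  · have : Tendsto (fun σ : ℝ => 1 + σ) (𝓝 0) (𝓝 (1 + 0)) := tendsto_const_nhds.add tendsto_id
    rw [add_zero] at this
    exact this.mono_left nhdsWithin_le_nhds
  · filter_upwards [self_mem_nhdsWithin] with σ hσ
    simpa using hσ

theorem tendsto_tsum_logEulerTerm_add_log :
    Tendsto (fun σ : ℝ => ∑' n, logEulerTerm (1 + σ) n + Real.log σ) (𝓝[>] 0) (𝓝 0) := by
  have h := tendsto_sub_mul_tsum_nat_rpow.comp tendsto_one_add_nhdsGT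
  have h2 := h.log one_ne_zero
  rw [Real.log_one] at h2
  refine h2.congr' ?_
  filter_upwards [self_mem_nhdsWithin] with σ hσ
  have hσ : 0 < σ := hσ
  simp only [Function.comp]
  rw [← exp_tsum_logEulerTerm (by linarith), add_sub_cancel_left,
    Real.log_mul hσ.ne' (Real.exp_ne_zero _), Real.log_exp, add_comm]

theorem summable_mertensWeight_mul_rpow {σ : ℝ} (hσ : 0 < σ) :
    Summable fun n : ℕ => mertensWeight n * (n : ℝ) ^ (-σ) := by
  have hle : ∀ n : ℕ, 1 ≤ n → (n : ℝ) ^ (-σ) ≤ 1 := fun n hn =>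
    Real.rpow_le_one_of_one_le_of_nonpos (by exact_mod_cast hn) (by linarith)
  refine Summable.of_nonneg_of_le
    (fun n => mul_nonneg (mertensWeight_nonneg n) (by positivity)) (fun n => ?_)
    ((summable_prime_rpow (by linarith : 1 < 1 + σ)).add (summable_inv_sq.mul_left 2))
  have h := abs_logEulerTerm_sub_le le_rfl n
  rw [logEulerTerm_one] at h
  have h' := (abs_le.1 h).2
  by_cases hn : n.Prime
  · simp only [hn, if_true] at h' ⊢
    have hn0 : (0 : ℝ) < n := by exact_mod_cast hn.pos
    have hx : 0 ≤ (n : ℝ) ^ (-σ) := by positivity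
    calc _ ≤ ((n : ℝ) ^ (-1 : ℝ) + 2 * ((n : ℝ) ^ 2)⁻¹) * (n : ℝ) ^ (-σ) := by
          gcongr; linarith
      _ = (n : ℝ) ^ (-(1 + σ)) + 2 * ((n : ℝ) ^ 2)⁻¹ * (n : ℝ) ^ (-σ) := by
          rw [add_mul, ← Real.rpow_add hn0]; ring_nf
      _ ≤ _ := add_le_add le_rfl
          (mul_le_of_le_one_right (by positivity) (hle n hn.one_le))
  · simp only [mertensWeight, hn, if_false, zero_mul, zero_add]
    positivity

theorem tendsto_natCast_rpow_neg {n : ℕ} (hn : 1 ≤ n) (a : ℝ) :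
    Tendsto (fun σ : ℝ => (n : ℝ) ^ (-(a + σ))) (𝓝[>] 0) (𝓝 ((n : ℝ) ^ (-a))) := by
  have hc : ContinuousAt (fun σ : ℝ => (n : ℝ) ^ (-(a + σ))) 0 := by
    refine ContinuousAt.rpow continuousAt_const (by fun_prop) (Or.inl ?_)
    exact_mod_cast (by omega : n ≠ 0)
  have := hc.tendsto
  simp only [add_zero] at this
  exact this.mono_left nhdsWithin_le_nhds

theorem tendsto_tsum_logEulerTerm_sub_mertensWeight :
    Tendsto (fun σ : ℝ => ∑' n, logEulerTerm (1 + σ) n -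
      ∑' n : ℕ, mertensWeight n * (n : ℝ) ^ (-σ)) (𝓝[>] 0) (𝓝 0) := by
  have hmain : Tendsto (fun σ : ℝ => ∑' n : ℕ, (logEulerTerm (1 + σ) n -
      mertensWeight n * (n : ℝ) ^ (-σ))) (𝓝[>] 0) (𝓝 (∑' n : ℕ, (0 : ℝ))) := by
    refine tendsto_tsum_of_dominated_convergence (bound := fun n : ℕ => 4 * ((n : ℝ) ^ 2)⁻¹)
      (summable_inv_sq.mul_left 4) (fun n => ?_) ?_
    · by_cases hn : n.Prime
      · have h1 := tendsto_natCast_rpow_neg hn.one_le 1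
        have h0 := tendsto_natCast_rpow_neg hn.one_le 0
        simp only [zero_add, neg_zero, Real.rpow_zero] at h0
        have hne : 1 - (n : ℝ) ^ (-1 : ℝ) ≠ 0 := by
          have := (rpow_neg_le_inv le_rfl hn.one_le).trans hn.cast_inv_le_half
          linarith
        have h2 := ((h1.const_sub 1).log hne).neg.sub (h0.const_mul (mertensWeight n))
        rw [← logEulerTerm_one] at h2 ⊢
        simpa [logEulerTerm, hn] using h2
      · simp [logEulerTerm, mertensWeight, hn]
    · filter_upwards [self_mem_nhdsWithin] with σ hσ n
      have hσ : 0 < σ := hσ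
      by_cases hn : n.Prime
      · have hn0 : (0 : ℝ) < n := by exact_mod_cast hn.pos
        have h1 := abs_logEulerTerm_sub_le (by linarith : 1 ≤ 1 + σ) n
        have h2 := abs_logEulerTerm_sub_le le_rfl n
        rw [logEulerTerm_one] at h2
        simp only [hn, if_true] at h1 h2
        have hle : (n : ℝ) ^ (-σ) ≤ 1 :=
          Real.rpow_le_one_of_one_le_of_nonpos (by exact_mod_cast hn.one_le) (by linarith)
        have hx : 0 ≤ (n : ℝ) ^ (-σ) := by positivity
        have h3 : |(mertensWeight n - (n : ℝ) ^ (-1 : ℝ)) * (n : ℝ) ^ (-σ)| ≤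
            2 * ((n : ℝ) ^ 2)⁻¹ := by
          rw [abs_mul, abs_of_nonneg hx]
          exact (mul_le_of_le_one_right (abs_nonneg _) hle).trans h2
        have e : logEulerTerm (1 + σ) n - mertensWeight n * (n : ℝ) ^ (-σ) =
            (logEulerTerm (1 + σ) n - (n : ℝ) ^ (-(1 + σ))) -
              (mertensWeight n - (n : ℝ) ^ (-1 : ℝ)) * (n : ℝ) ^ (-σ) := by
          have : (n : ℝ) ^ (-(1 + σ)) = (n : ℝ) ^ (-1 : ℝ) * (n : ℝ) ^ (-σ) := by
            rw [← Real.rpow_add hn0]; ring_nf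
          rw [this]; ring
        rw [Real.norm_eq_abs, e]
        rw [abs_le] at h1 h3 ⊢
        constructor <;> linarith
      · simp only [logEulerTerm, mertensWeight, hn, if_false, zero_mul, sub_zero, norm_zero]
        positivity
  rw [tsum_zero] at hmain
  refine hmain.congr' ?_
  filter_upwards [self_mem_nhdsWithin] with σ hσ
  have hσ : 0 < σ := hσ
  exact (summable_logEulerTerm (by linarith)).tsum_sub (summable_mertensWeight_mul_rpow hσ)

/-- The least natural number exceeding `exp m`. -/
noncomputable def expCut (m : ℕ) : ℕ := ⌊Real.exp m⌋₊ + 1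

theorem expCut_mono : Monotone expCut := fun a b h =>
  Nat.succ_le_succ (Nat.floor_mono (Real.exp_le_exp.2 (by exact_mod_cast h)))

theorem exp_lt_expCut (m : ℕ) : Real.exp m < expCut m := by
  simpa [expCut] using Nat.lt_floor_add_one (Real.exp m)

theorem expCut_le (m : ℕ) : (expCut m : ℝ) ≤ 2 * Real.exp m := by
  have h1 := Nat.floor_le (Real.exp_pos m).le
  have h2 := Real.one_le_exp (Nat.cast_nonneg (α := ℝ) m)
  simp only [expCut, Nat.cast_add, Nat.cast_one]
  linarith

theorem lt_expCut_iff {n m : ℕ} : n < expCut m ↔ (n : ℝ) ≤ Real.exp m := by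
  rw [expCut, Nat.lt_succ_iff, Nat.le_floor_iff (Real.exp_pos _).le]

theorem tendsto_expCut : Tendsto expCut atTop atTop := by
  refine tendsto_atTop_mono (fun m => ?_) tendsto_id
  have h1 := exp_lt_expCut m
  have h2 := Real.add_one_le_exp (m : ℝ)
  have h3 : (m : ℝ) ≤ expCut m := by linarith
  exact_mod_cast h3

theorem tendsto_log_log_expCut_sub_log :
    Tendsto (fun m : ℕ => Real.log (Real.log (expCut m)) - Real.log m) atTop (𝓝 0) := by
  have hz : Tendsto (fun m : ℕ => Real.log 2 / (m : ℝ)) atTop (𝓝 0) :=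
    tendsto_const_div_atTop_nhds_zero_nat _
  refine tendsto_of_tendsto_of_tendsto_of_le_of_le' tendsto_const_nhds hz ?_ ?_
  · filter_upwards [eventually_ge_atTop 1] with m hm
    have hm0 : (0 : ℝ) < m := by exact_mod_cast hm
    have h1 : (m : ℝ) ≤ Real.log (expCut m) := by
      rw [Real.le_log_iff_exp_le ((Real.exp_pos _).trans (exp_lt_expCut m))]
      exact (exp_lt_expCut m).le
    have := Real.log_le_log hm0 h1
    linarith
  · filter_upwards [eventually_ge_atTop 1] with m hm
    have hm0 : (0 : ℝ) < m := by exact_mod_cast hm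
    have hpos := (Real.exp_pos _).trans (exp_lt_expCut m)
    have h1 : (m : ℝ) ≤ Real.log (expCut m) := by
      rw [Real.le_log_iff_exp_le hpos]
      exact (exp_lt_expCut m).le
    have h2 : Real.log (expCut m) ≤ m + Real.log 2 := by
      have := Real.log_le_log hpos (expCut_le m)
      rwa [Real.log_mul (by norm_num) (Real.exp_ne_zero _), Real.log_exp, add_comm] at this
    rw [← Real.log_div (by linarith) hm0.ne']
    have h3 := Real.log_le_sub_one_of_pos (x := Real.log (expCut m) / m)
      (div_pos (by linarith) hm0)
    have h4 : Real.log (expCut m) / m ≤ 1 + Real.log 2 / m := by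
      rw [div_le_iff₀ hm0]; field_simp; linarith
    linarith

/-- The sum of the weights of the primes in `(exp m, exp (m + 1)]`. -/
noncomputable def expBlock (m : ℕ) : ℝ := ∑ n ∈ Ico (expCut m) (expCut (m + 1)), mertensWeight n

theorem expBlock_nonneg (m : ℕ) : 0 ≤ expBlock m :=
  Finset.sum_nonneg fun n _ => mertensWeight_nonneg n

theorem sum_range_blocks (g : ℕ → ℝ) (h0 : ∀ n, ¬ n.Prime → g n = 0) (M : ℕ) :
    ∑ m ∈ range M, ∑ n ∈ Ico (expCut m) (expCut (m + 1)), g n = ∑ n ∈ range (expCut M), g n := by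
  induction M with
  | zero =>
    symm
    refine Finset.sum_eq_zero fun n hn => h0 n fun hp => ?_
    have h1 := lt_expCut_iff.1 (Finset.mem_range.1 hn)
    rw [Nat.cast_zero, Real.exp_zero] at h1
    have h2 : n ≤ 1 := by exact_mod_cast h1
    exact absurd hp.two_le (by omega)
  | succ M ih =>
    rw [Finset.sum_range_succ, ih, Finset.sum_range_add_sum_Ico _ (expCut_mono (Nat.le_succ M))]

theorem mertensWeight_of_not_prime {n : ℕ} (h : ¬ n.Prime) : mertensWeight n = 0 := if_neg h

theorem expBlock_bounds {σ : ℝ} (hσ : 0 < σ) (m : ℕ) :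
    expBlock m * Real.exp (-σ) ^ (m + 1) ≤
        ∑ n ∈ Ico (expCut m) (expCut (m + 1)), mertensWeight n * (n : ℝ) ^ (-σ) ∧
      ∑ n ∈ Ico (expCut m) (expCut (m + 1)), mertensWeight n * (n : ℝ) ^ (-σ) ≤
        expBlock m * Real.exp (-σ) ^ m := by
  have hpow : ∀ j : ℕ, Real.exp (-σ) ^ j = Real.exp j ^ (-σ) := by
    intro j
    rw [← Real.exp_nat_mul, ← Real.exp_mul]
  rw [expBlock, Finset.sum_mul, Finset.sum_mul]
  constructor
  · refine Finset.sum_le_sum fun n hn => mul_le_mul_of_nonneg_left ?_ (mertensWeight_nonneg n)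
    obtain ⟨h1, h2⟩ := Finset.mem_Ico.1 hn
    have hn0 : (0 : ℝ) < n := by
      exact_mod_cast lt_of_lt_of_le (Nat.succ_pos _) h1
    rw [hpow]
    exact Real.rpow_le_rpow_of_nonpos hn0 (lt_expCut_iff.1 h2) (by linarith)
  · refine Finset.sum_le_sum fun n hn => mul_le_mul_of_nonneg_left ?_ (mertensWeight_nonneg n)
    obtain ⟨h1, h2⟩ := Finset.mem_Ico.1 hn
    have h3 : Real.exp m ≤ n := by
      by_contra h
      exact absurd (lt_expCut_iff.2 (not_le.1 h).le) (not_lt.2 h1)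
    rw [hpow]
    exact Real.rpow_le_rpow_of_nonpos (Real.exp_pos _) h3 (by linarith)

theorem hasSum_blocks {σ : ℝ} (hσ : 0 < σ) :
    HasSum (fun m => ∑ n ∈ Ico (expCut m) (expCut (m + 1)), mertensWeight n * (n : ℝ) ^ (-σ))
      (∑' n : ℕ, mertensWeight n * (n : ℝ) ^ (-σ)) := by
  rw [hasSum_iff_tendsto_nat_of_nonneg (fun m => Finset.sum_nonneg fun n _ =>
    mul_nonneg (mertensWeight_nonneg n) (by positivity))]
  have h := (summable_mertensWeight_mul_rpow hσ).hasSum.tendsto_sum_nat.comp tendsto_expCut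
  refine h.congr fun M => ?_
  rw [sum_range_blocks _ (fun n hn => by rw [mertensWeight_of_not_prime hn, zero_mul])]
  rfl

theorem summable_expBlock {σ : ℝ} (hσ : 0 < σ) :
    Summable fun m => expBlock m * Real.exp (-σ) ^ m := by
  have h : Summable fun m => expBlock m * Real.exp (-σ) ^ (m + 1) :=
    Summable.of_nonneg_of_le (fun m => mul_nonneg (expBlock_nonneg m) (by positivity))
      (fun m => (expBlock_bounds hσ m).1) (hasSum_blocks hσ).summable
  refine (h.mul_right (Real.exp σ)).congr fun m => ?_
  rw [pow_succ, mul_assoc, mul_assoc, ← Real.exp_add, neg_add_cancel, Real.exp_zero, mul_one]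

theorem tsum_expBlock_bounds {σ : ℝ} (hσ : 0 < σ) :
    Real.exp (-σ) * ∑' m, expBlock m * Real.exp (-σ) ^ m ≤
        ∑' n : ℕ, mertensWeight n * (n : ℝ) ^ (-σ) ∧
      ∑' n : ℕ, mertensWeight n * (n : ℝ) ^ (-σ) ≤ ∑' m, expBlock m * Real.exp (-σ) ^ m := by
  have hs := summable_expBlock hσ
  rw [← (hasSum_blocks hσ).tsum_eq]
  constructor
  · rw [← tsum_mul_left]
    refine (hs.mul_left _).tsum_le_tsum (fun m => ?_) (hasSum_blocks hσ).summable
    refine le_of_eq_of_le ?_ (expBlock_bounds hσ m).1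
    rw [pow_succ]; ring
  · exact (hasSum_blocks hσ).summable.tsum_le_tsum (fun m => (expBlock_bounds hσ m).2) hs

theorem tendsto_sum_expBlock_sub {c K : ℝ} (hc : ∀ n : ℕ, 3 ≤ n →
      |∑ i ∈ range n, mertensWeight i - Real.log (Real.log n) - c| ≤ K / Real.log n) :
    Tendsto (fun M => ∑ m ∈ range M, (expBlock m - 1 / ((m : ℝ) + 1))) atTop
      (𝓝 (c - Real.eulerMascheroniConstant)) := by
  have h1 : Tendsto (fun n : ℕ => ∑ i ∈ range n, mertensWeight i - Real.log (Real.log n) - c)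
      atTop (𝓝 0) := by
    have hlim : Tendsto (fun n : ℕ => K / Real.log (n : ℝ)) atTop (𝓝 0) :=
      (Real.tendsto_log_atTop.comp tendsto_natCast_atTop_atTop).const_div_atTop K
    refine squeeze_zero_norm' ?_ hlim
    filter_upwards [eventually_ge_atTop 3] with n hn
    exact hc n hn
  have h2 := ((h1.comp tendsto_expCut).add tendsto_log_log_expCut_sub_log).sub
    Real.tendsto_harmonic_sub_log
  have h3 := h2.add_const c
  refine (h3.congr fun M => ?_).trans (le_of_eq (by congr 1; ring))
  have hb : ∑ m ∈ range M, expBlock m = ∑ n ∈ range (expCut M), mertensWeight n :=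
    sum_range_blocks _ (fun n hn => mertensWeight_of_not_prime hn) M
  rw [Finset.sum_sub_distrib, hb]
  simp only [Function.comp, harmonic]
  push_cast
  simp only [one_div]
  ring

theorem tendsto_exp_neg_nhdsGT : Tendsto (fun σ : ℝ => Real.exp (-σ)) (𝓝[>] 0) (𝓝[<] 1) := by
  refine tendsto_nhdsWithin_iff.2 ⟨?_, ?_⟩
  · have : Tendsto (fun σ : ℝ => Real.exp (-σ)) (𝓝 0) (𝓝 (Real.exp (-0))) :=
      (Real.continuous_exp.comp continuous_neg).tendsto 0
    rw [neg_zero, Real.exp_zero] at this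
    exact this.mono_left nhdsWithin_le_nhds
  · filter_upwards [self_mem_nhdsWithin] with σ hσ
    simpa using hσ

theorem tendsto_log_one_sub_exp_neg_sub_log :
    Tendsto (fun σ : ℝ => Real.log (1 - Real.exp (-σ)) - Real.log σ) (𝓝[>] 0) (𝓝 0) := by
  have hl : Tendsto (fun σ : ℝ => -σ) (𝓝[>] 0) (𝓝 0) := by
    have : Tendsto (fun σ : ℝ => -σ) (𝓝 0) (𝓝 (-0)) := continuous_neg.tendsto 0
    rw [neg_zero] at this
    exact this.mono_left nhdsWithin_le_nhds
  refine tendsto_of_tendsto_of_tendsto_of_le_of_le' hl tendsto_const_nhds ?_ ?_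
  · filter_upwards [self_mem_nhdsWithin] with σ hσ
    have hσ : 0 < σ := hσ
    have h1 : σ * Real.exp (-σ) ≤ 1 - Real.exp (-σ) := by
      have h2 := Real.add_one_le_exp σ
      have h3 : Real.exp σ * Real.exp (-σ) = 1 := by rw [← Real.exp_add]; simp
      nlinarith [Real.exp_pos (-σ)]
    have h2 := Real.log_le_log (mul_pos hσ (Real.exp_pos _)) h1
    rw [Real.log_mul hσ.ne' (Real.exp_ne_zero _), Real.log_exp] at h2
    linarith
  · filter_upwards [self_mem_nhdsWithin] with σ hσ
    have hσ : 0 < σ := hσ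
    have h1 := Real.add_one_le_exp (-σ)
    have h2 : Real.exp (-σ) < 1 := by rw [Real.exp_lt_one_iff]; linarith
    have := Real.log_le_log (x := 1 - Real.exp (-σ)) (y := σ) (by linarith) (by linarith)
    linarith

theorem mertens_constant_eq {c K : ℝ} (hc : ∀ n : ℕ, 3 ≤ n →
      |∑ i ∈ range n, mertensWeight i - Real.log (Real.log n) - c| ≤ K / Real.log n) :
    c = Real.eulerMascheroniConstant := by
  set Q : ℝ → ℝ := fun σ => ∑' n : ℕ, mertensWeight n * (n : ℝ) ^ (-σ) with hQ
  set T : ℝ → ℝ := fun σ => ∑' m, expBlock m * Real.exp (-σ) ^ m with hT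
  have habel := (Real.tendsto_tsum_powerSeries_nhdsWithin_lt
    (tendsto_sum_expBlock_sub hc)).comp tendsto_exp_neg_nhdsGT
  have hx : Tendsto (fun σ : ℝ => Real.exp (-σ)) (𝓝[>] 0) (𝓝 1) :=
    tendsto_exp_neg_nhdsGT.mono_right nhdsWithin_le_nhds
  have hA : Tendsto (fun σ => Real.exp (-σ) * T σ + Real.log (1 - Real.exp (-σ))) (𝓝[>] 0)
      (𝓝 (c - Real.eulerMascheroniConstant)) := by
    have h := hx.mul habel
    rw [one_mul] at h
    refine h.congr' ?_
    filter_upwards [self_mem_nhdsWithin] with σ hσ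
    have hσ : 0 < σ := hσ
    have h2 : Real.exp (-σ) < 1 := by rw [Real.exp_lt_one_iff]; linarith
    have hlog := Real.hasSum_pow_div_log_of_abs_lt_one (x := Real.exp (-σ))
      (by rw [abs_of_pos (Real.exp_pos _)]; exact h2)
    have hs := ((summable_expBlock hσ).hasSum.mul_left (Real.exp (-σ))).sub hlog
    simp only [Function.comp]
    rw [← tsum_mul_left, ← sub_neg_eq_add, ← hs.tsum_eq]
    refine tsum_congr fun m => ?_
    rw [pow_succ]; ring
  have hQlog : Tendsto (fun σ => Q σ + Real.log σ) (𝓝[>] 0) (𝓝 0) := by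
    have h := tendsto_tsum_logEulerTerm_add_log.sub tendsto_tsum_logEulerTerm_sub_mertensWeight
    rw [sub_zero] at h
    refine h.congr fun σ => ?_
    simp only [hQ]; ring
  have hid : Tendsto (fun σ : ℝ => σ) (𝓝[>] 0) (𝓝 0) := nhdsWithin_le_nhds
  have hσQ : Tendsto (fun σ => σ * Q σ) (𝓝[>] 0) (𝓝 0) := by
    have h1 : Tendsto (fun σ : ℝ => σ * Real.log σ) (𝓝[>] 0) (𝓝 0) := by
      have := Real.continuous_mul_log.tendsto 0
      simp only [zero_mul] at this
      exact this.mono_left nhdsWithin_le_nhds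
    have h2 := (hid.mul hQlog).sub h1
    rw [zero_mul, sub_zero] at h2
    refine h2.congr fun σ => ?_
    ring
  have hdiff : Tendsto (fun σ => Q σ - Real.exp (-σ) * T σ) (𝓝[>] 0) (𝓝 0) := by
    refine tendsto_of_tendsto_of_tendsto_of_le_of_le' tendsto_const_nhds hσQ ?_ ?_
    · filter_upwards [self_mem_nhdsWithin] with σ hσ
      have := (tsum_expBlock_bounds hσ).1
      simp only [hQ, hT]; linarith
    · filter_upwards [self_mem_nhdsWithin] with σ hσ
      have hb := (tsum_expBlock_bounds hσ).2
      have h1 := Real.add_one_le_exp (-σ)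
      have hQ0 : 0 ≤ Q σ := tsum_nonneg fun n =>
        mul_nonneg (mertensWeight_nonneg n) (by positivity)
      have h3 : Real.exp (-σ) * Q σ ≤ Real.exp (-σ) * T σ :=
        mul_le_mul_of_nonneg_left hb (Real.exp_pos _).le
      nlinarith
  have hzero : Tendsto (fun σ => Real.exp (-σ) * T σ + Real.log (1 - Real.exp (-σ))) (𝓝[>] 0)
      (𝓝 0) := by
    have h := (hQlog.sub hdiff).add tendsto_log_one_sub_exp_neg_sub_log
    rw [sub_zero, add_zero] at h
    refine h.congr fun σ => ?_
    ring
  have := tendsto_nhds_unique hA hzero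
  linarith

/-- Mertens' third theorem. -/
theorem exists_abs_sum_mertensWeight_sub_le :
    ∃ K : ℝ, 0 ≤ K ∧ ∀ n : ℕ, 3 ≤ n →
      |∑ i ∈ range n, mertensWeight i - Real.log (Real.log n) - Real.eulerMascheroniConstant| ≤
        K / Real.log n := by
  obtain ⟨c, K, hK, hc⟩ := exists_mertens_constant
  exact ⟨K, hK, mertens_constant_eq hc ▸ hc⟩

theorem nuH_le_card (H : Finset ℤ) (p : ℕ) : nuH H p ≤ H.card := Finset.card_image_le

theorem nuH_image_eq_card {k : ℕ} {f : Fin k → ℕ} {p : ℕ}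
    (hp : ¬ (p : ℤ) ∣ ∏ i : Fin k, ∏ j ∈ Finset.univ.filter (fun j => i < j),
      ((f i : ℤ) - (f j : ℤ))) :
    nuH (Finset.image (fun i => (f i : ℤ)) Finset.univ) p =
      (Finset.image (fun i => (f i : ℤ)) Finset.univ).card := by
  have key : ∀ i j : Fin k, i < j → ¬ (p : ℤ) ∣ (f i : ℤ) - (f j : ℤ) := fun i j hij h =>
    hp ((h.trans (Finset.dvd_prod_of_mem (fun j => (f i : ℤ) - (f j : ℤ)) (by simpa using hij))).trans
      (Finset.dvd_prod_of_mem (fun i => ∏ j ∈ Finset.univ.filter (fun j => i < j),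
        ((f i : ℤ) - (f j : ℤ))) (Finset.mem_univ i)))
  refine Finset.card_image_of_injOn fun x hx y hy hxy => ?_
  obtain ⟨i, -, rfl⟩ := Finset.mem_image.1 (Finset.mem_coe.1 hx)
  obtain ⟨j, -, rfl⟩ := Finset.mem_image.1 (Finset.mem_coe.1 hy)
  have hxy : (f i : ℤ) % p = (f j : ℤ) % p := hxy
  rcases lt_trichotomy i j with h | h | h
  · exact absurd (Int.ModEq.dvd hxy.symm) (key i j h)
  · rw [h]
  · exact absurd (Int.ModEq.dvd hxy) (key j i h)

theorem prod_sub_ne_zero {k : ℕ} {f : Fin k → ℕ} (hf : Function.Injective f) :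
    ∏ i : Fin k, ∏ j ∈ Finset.univ.filter (fun j => i < j), ((f i : ℤ) - (f j : ℤ)) ≠ 0 := by
  refine Finset.prod_ne_zero_iff.2 fun i _ => Finset.prod_ne_zero_iff.2 fun j hj => ?_
  have hij : i < j := by simpa using hj
  rw [sub_ne_zero]
  exact_mod_cast fun h => hij.ne (hf h)

/-- The logarithm of the local factor of the singular series, extended by zero. -/
noncomputable def logLocalFactor (H : Finset ℤ) (n : ℕ) : ℝ :=
  if n.Prime then
    Real.log (1 - (nuH H n : ℝ) / n) - H.card * Real.log (1 - 1 / (n : ℝ)) else 0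

theorem one_sub_nuH_div_pos {H : Finset ℤ} (hH : Admissible H) {p : ℕ} (hp : p.Prime) :
    0 < 1 - (nuH H p : ℝ) / p := by
  have hp0 : (0 : ℝ) < p := by exact_mod_cast hp.pos
  rw [sub_pos, div_lt_one hp0]
  exact_mod_cast hH p hp

theorem one_sub_one_div_pos {p : ℕ} (hp : p.Prime) : 0 < 1 - 1 / (p : ℝ) := by
  have := hp.cast_inv_le_half
  rw [one_div (p : ℝ)]
  linarith

theorem logLocalFactor_eq_log {H : Finset ℤ} (hH : Admissible H) {p : ℕ} (hp : p.Prime) :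
    logLocalFactor H p =
      Real.log ((1 - (nuH H p : ℝ) / p) / (1 - 1 / (p : ℝ)) ^ H.card) := by
  rw [logLocalFactor, if_pos hp, Real.log_div (one_sub_nuH_div_pos hH hp).ne'
    (pow_pos (one_sub_one_div_pos hp) _).ne', Real.log_pow]

theorem singSeries_eq_exp {H : Finset ℤ} (hH : Admissible H) (hs : Summable (logLocalFactor H)) :
    singSeries H = Real.exp (∑' n, logLocalFactor H n) := by
  have hsub : ∑' n, logLocalFactor H n = ∑' p : Nat.Primes, logLocalFactor H p := by
    refine (tsum_subtype_eq_of_support_subset (s := {p : ℕ | p.Prime}) ?_).symm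
    intro n hn
    by_contra h
    exact hn (if_neg h)
  have hs' : Summable fun p : Nat.Primes => logLocalFactor H p := hs.subtype {p : ℕ | p.Prime}
  have he := fun p : Nat.Primes => logLocalFactor_eq_log hH p.2
  rw [hsub]
  simp_rw [he] at hs' ⊢
  rw [Real.rexp_tsum_eq_tprod (fun p => ?_) hs', singSeries]
  exact div_pos (one_sub_nuH_div_pos hH p.2) (pow_pos (one_sub_one_div_pos p.2) _)

theorem WSel_eq_exp {H : Finset ℤ} (hH : Admissible H) (z : ℝ) :
    WSel H z = Real.exp (∑ n ∈ range ⌈z⌉₊, logLocalFactor H n -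
      H.card * ∑ n ∈ range ⌈z⌉₊, mertensWeight n) := by
  rw [Finset.mul_sum, ← Finset.sum_sub_distrib, Real.exp_sum, WSel, Finset.prod_filter]
  refine Finset.prod_congr rfl fun p _ => ?_
  split_ifs with hp
  · rw [logLocalFactor, mertensWeight, if_pos hp, if_pos hp]
    rw [show ∀ a b c : ℝ, a - b * c - b * -c = a by intros; ring,
      Real.exp_log (one_sub_nuH_div_pos hH hp)]
  · simp [logLocalFactor, mertensWeight, hp]

theorem abs_logLocalFactor_le {H : Finset ℤ} {D : ℤ} (hH1 : 1 ≤ H.card)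
    (hD : ∀ p : ℕ, p.Prime → ¬ (p : ℤ) ∣ D → nuH H p = H.card) {n : ℕ} (hn : 2 * H.card ≤ n) :
    |logLocalFactor H n| ≤ 4 * (H.card : ℝ) ^ 2 * ((n : ℝ) ^ 2)⁻¹ +
      if n.Prime ∧ (n : ℤ) ∣ D then (H.card : ℝ) / n else 0 := by
  set k : ℝ := (H.card : ℝ) with hk
  have hk1 : 1 ≤ k := by rw [hk]; exact_mod_cast hH1
  by_cases hp : n.Prime
  · have hn0 : (0 : ℝ) < n := by exact_mod_cast hp.pos
    have hn2 : 2 * k ≤ n := by rw [hk]; exact_mod_cast hn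
    set x : ℝ := (nuH H n : ℝ) / n with hx
    have hνk : (nuH H n : ℝ) ≤ k := by rw [hk]; exact_mod_cast nuH_le_card H n
    have hxk : x ≤ k / n := by rw [hx]; gcongr
    have hx0 : 0 ≤ x := by positivity
    have hkn : k / n ≤ 1 / 2 := by rw [div_le_div_iff₀ hn0 (by norm_num)]; linarith
    have h1 := abs_log_one_sub_add_le hx0 (hxk.trans hkn)
    have h2 := abs_log_one_sub_add_le (x := 1 / (n : ℝ)) (by positivity)
      (by rw [one_div (n : ℝ)]; exact hp.cast_inv_le_half)
    have hxsq : x ^ 2 ≤ k ^ 2 * ((n : ℝ) ^ 2)⁻¹ := by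
      calc x ^ 2 ≤ (k / n) ^ 2 := by gcongr
        _ = _ := by rw [div_pow, div_eq_mul_inv]
    have hsq : 0 ≤ ((n : ℝ) ^ 2)⁻¹ := by positivity
    have hkk : k * ((n : ℝ) ^ 2)⁻¹ ≤ k ^ 2 * ((n : ℝ) ^ 2)⁻¹ := by
      gcongr; nlinarith
    have h2' : |k * (Real.log (1 - 1 / (n : ℝ)) + 1 / n)| ≤ 2 * (k * ((n : ℝ) ^ 2)⁻¹) := by
      rw [abs_mul, abs_of_nonneg (by linarith)]
      calc _ ≤ k * (2 * (1 / (n : ℝ)) ^ 2) := by gcongr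
        _ = _ := by rw [one_div, inv_pow]; ring
    have h3 : |k / n - x| ≤ if n.Prime ∧ (n : ℤ) ∣ D then k / n else 0 := by
      split_ifs with hd
      · rw [abs_le]; constructor <;> linarith
      · have : nuH H n = H.card := hD n hp fun h => hd ⟨hp, h⟩
        rw [hx, this]
        simp [hk]
    have e : logLocalFactor H n = (Real.log (1 - x) + x) -
        k * (Real.log (1 - 1 / (n : ℝ)) + 1 / n) + (k / n - x) := by
      rw [logLocalFactor, if_pos hp]; ring
    rw [e]
    rw [abs_le] at h1 h2' h3 ⊢
    constructor <;> linarith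
  · rw [logLocalFactor, if_neg hp, abs_zero]
    split_ifs <;> positivity

theorem card_prime_dvd_le {D : ℤ} (hD : D ≠ 0) (s : Finset ℕ) :
    ((s.filter fun n : ℕ => n.Prime ∧ (n : ℤ) ∣ D).card : ℝ) ≤ 2 * Real.log (3 * |(D : ℝ)|) := by
  have hDn : D.natAbs ≠ 0 := Int.natAbs_ne_zero.2 hD
  have h1 : (s.filter fun n : ℕ => n.Prime ∧ (n : ℤ) ∣ D).card ≤ D.natAbs.primeFactors.card := by
    refine Finset.card_le_card fun n hn => ?_
    obtain ⟨-, hp, hd⟩ := Finset.mem_filter.1 hn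
    exact Nat.mem_primeFactors.2 ⟨hp, Int.natCast_dvd.1 hd, hDn⟩
  have h2 : 2 ^ D.natAbs.primeFactors.card ≤ D.natAbs :=
    (Finset.pow_card_le_prod _ _ 2 fun p hp => (Nat.prime_of_mem_primeFactors hp).two_le).trans
      (Nat.le_of_dvd (Nat.pos_of_ne_zero hDn) (Nat.prod_primeFactors_dvd _))
  have h3 : (2 : ℝ) ^ D.natAbs.primeFactors.card ≤ 3 * |(D : ℝ)| := by
    have h4 : (2 : ℝ) ^ D.natAbs.primeFactors.card ≤ (D.natAbs : ℝ) := by exact_mod_cast h2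
    rw [Nat.cast_natAbs, Int.cast_abs] at h4
    linarith [abs_nonneg (D : ℝ)]
  have h5 := Real.log_le_log (by positivity) h3
  rw [Real.log_pow] at h5
  have h6 : ((s.filter fun n : ℕ => n.Prime ∧ (n : ℤ) ∣ D).card : ℝ) ≤ D.natAbs.primeFactors.card := by
    exact_mod_cast h1
  nlinarith [Real.log_two_gt_d9, Nat.cast_nonneg (α := ℝ) D.natAbs.primeFactors.card]

theorem sum_range_abs_logLocalFactor_le {H : Finset ℤ} {D : ℤ} (hH1 : 1 ≤ H.card) (hD0 : D ≠ 0)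
    (hD : ∀ p : ℕ, p.Prime → ¬ (p : ℤ) ∣ D → nuH H p = H.card) {N : ℕ} (hN : 2 * H.card ≤ N)
    (M : ℕ) :
    ∑ i ∈ range M, |logLocalFactor H (i + N)| ≤
      8 * (H.card : ℝ) ^ 2 / N + 2 * H.card * Real.log (3 * |(D : ℝ)|) / N := by
  have hN0 : (0 : ℝ) < N := by exact_mod_cast (by omega : 0 < N)
  have e : ∑ i ∈ range M, |logLocalFactor H (i + N)| = ∑ n ∈ Ico N (N + M), |logLocalFactor H n| := by
    rw [Finset.sum_Ico_eq_sum_range, Nat.add_sub_cancel_left]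
    exact Finset.sum_congr rfl fun i _ => by rw [add_comm]
  rw [e]
  calc _ ≤ ∑ n ∈ Ico N (N + M), (4 * (H.card : ℝ) ^ 2 * ((n : ℝ) ^ 2)⁻¹ +
        if n.Prime ∧ (n : ℤ) ∣ D then (H.card : ℝ) / N else 0) := by
        refine Finset.sum_le_sum fun n hn => ?_
        have hNn := (Finset.mem_Ico.1 hn).1
        refine (abs_logLocalFactor_le hH1 hD (hN.trans hNn)).trans (add_le_add le_rfl ?_)
        split_ifs
        · gcongr
        · exact le_rfl
    _ ≤ 4 * (H.card : ℝ) ^ 2 * (2 / N) +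
        2 * Real.log (3 * |(D : ℝ)|) * ((H.card : ℝ) / N) := by
        rw [Finset.sum_add_distrib, ← Finset.mul_sum, ← Finset.sum_filter, Finset.sum_const,
          nsmul_eq_mul]
        gcongr
        · exact sum_Ico_inv_sq_le (by omega) _
        · exact card_prime_dvd_le hD0 _
    _ = _ := by ring

theorem exists_log_singSeries_tail {H : Finset ℤ} {D : ℤ} (hA : Admissible H) (hH1 : 1 ≤ H.card)
    (hD0 : D ≠ 0) (hD : ∀ p : ℕ, p.Prime → ¬ (p : ℤ) ∣ D → nuH H p = H.card) {N : ℕ}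
    (hN : 2 * H.card ≤ N) :
    ∃ t : ℝ, singSeries H = Real.exp (∑ n ∈ range N, logLocalFactor H n + t) ∧
      |t| ≤ 8 * (H.card : ℝ) ^ 2 / N + 2 * H.card * Real.log (3 * |(D : ℝ)|) / N := by
  have hb := sum_range_abs_logLocalFactor_le hH1 hD0 hD hN
  have hs := summable_of_sum_range_le (fun _ => abs_nonneg _) hb
  have hs' : Summable (logLocalFactor H) := (summable_nat_add_iff N).1 hs.of_abs
  refine ⟨∑' i, logLocalFactor H (i + N), ?_, ?_⟩
  · rw [singSeries_eq_exp hA hs', hs'.sum_add_tsum_nat_add N]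
  · calc _ ≤ ∑' i, |logLocalFactor H (i + N)| := by
          have := norm_tsum_le_tsum_norm (f := fun i => logLocalFactor H (i + N)) hs
          exact this
      _ ≤ _ := Real.tsum_le_of_sum_range_le (fun _ => abs_nonneg _) hb

theorem exists_abs_sum_mertensWeight_range_ceil_sub_le :
    ∃ K : ℝ, 0 ≤ K ∧ ∀ z : ℝ, 3 ≤ z →
      |∑ i ∈ range ⌈z⌉₊, mertensWeight i - Real.log (Real.log z) -
        Real.eulerMascheroniConstant| ≤ K / Real.log z := by
  obtain ⟨K, hK0, hK⟩ := exists_abs_sum_mertensWeight_sub_le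
  refine ⟨K + 1, by linarith, fun z hz => ?_⟩
  have hlz : 1 ≤ Real.log z := (one_le_log_natCast (n := 3) le_rfl).trans
    (Real.log_le_log (by norm_num) (by exact_mod_cast hz))
  have hz1 : z ≤ ⌈z⌉₊ := Nat.le_ceil z
  have hz2 : (⌈z⌉₊ : ℝ) < z + 1 := Nat.ceil_lt_add_one (by linarith)
  have h3 : 3 ≤ ⌈z⌉₊ := by exact_mod_cast hz.trans hz1
  have hl1 : Real.log z ≤ Real.log ⌈z⌉₊ := Real.log_le_log (by linarith) hz1
  have hl2 : Real.log ⌈z⌉₊ ≤ Real.log z + 1 := by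
    have h := Real.log_le_sub_one_of_pos (x := (⌈z⌉₊ : ℝ) / z) (by positivity)
    rw [Real.log_div (by positivity) (by positivity)] at h
    have h' : (⌈z⌉₊ : ℝ) / z ≤ 2 := by rw [div_le_iff₀ (by linarith)]; linarith
    linarith
  have h1 := (hK _ h3).trans
    (div_le_div_of_nonneg_left hK0 (by linarith) hl1 : K / Real.log ⌈z⌉₊ ≤ K / Real.log z)
  have h2 : Real.log (Real.log ⌈z⌉₊) - Real.log (Real.log z) ≤ 1 / Real.log z := by
    rw [← Real.log_div (by linarith) (by linarith)]
    refine (Real.log_le_sub_one_of_pos (div_pos (by linarith) (by linarith))).trans ?_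
    rw [div_sub_one (by linarith)]
    gcongr
    linarith
  have h4 := Real.log_le_log (by linarith) hl1
  rw [add_div]
  rw [abs_le] at h1 ⊢
  constructor <;> linarith

end

/-- There exist absolute constants `B, C > 0` such that: for `k ≥ 1`, an admissible set
`𝓗` of `k` distinct natural numbers, `D_𝓗 = ∏_{i<j}(hᵢ-hⱼ)`, `L = k log log(3|D_𝓗|)`,
and `z ≥ 2` with `L ≤ (1/B) log z` and `k² ≤ (1/B) log z`, one has
`|W(z) - 𝔖(𝓗) e^(-γk)/(log z)^k| ≤ C 𝔖(𝓗) e^(-γk) (log z)^(-k) (L + k³)/log z`. -/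
theorem WSel_asymptotic :
    ∃ B > (0 : ℝ), ∃ C > (0 : ℝ), ∀ k : ℕ, 1 ≤ k → ∀ f : Fin k → ℕ,
      Function.Injective f →
      ∀ H : Finset ℤ, H = Finset.image (fun i => (f i : ℤ)) Finset.univ →
      Admissible H →
      ∀ D : ℤ, D = (∏ i : Fin k, ∏ j ∈ Finset.univ.filter (fun j => i < j),
        ((f i : ℤ) - (f j : ℤ))) →
      ∀ L : ℝ, L = (k : ℝ) * Real.log (Real.log (3 * |(D : ℝ)|)) →
      ∀ z : ℝ, 2 ≤ z → L ≤ (1 / B) * Real.log z → (k : ℝ) ^ 2 ≤ (1 / B) * Real.log z →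
      |WSel H z -
          singSeries H * Real.exp (-(Real.eulerMascheroniConstant * k)) / Real.log z ^ k| ≤
        C * singSeries H * Real.exp (-(Real.eulerMascheroniConstant * k)) *
          (Real.log z ^ k)⁻¹ * (L + (k : ℝ) ^ 3) / Real.log z := by
  obtain ⟨K, hK0, hK⟩ := exists_abs_sum_mertensWeight_range_ceil_sub_le
  refine ⟨12 + K, by linarith, 2 * (12 + K), by linarith, ?_⟩
  intro k hk f hf H hH hA D hD L hL z hz hLz hkz
  have hcard : H.card = k := by
    rw [hH, Finset.card_image_of_injective _ (fun a b h => hf (by exact_mod_cast h))]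
    simp
  have hD0 : D ≠ 0 := hD ▸ prod_sub_ne_zero hf
  have hν : ∀ p : ℕ, p.Prime → ¬ (p : ℤ) ∣ D → nuH H p = H.card := by
    intro p _ hp
    rw [hD] at hp
    rw [hH]
    exact nuH_image_eq_card hp
  have hk1 : (1 : ℝ) ≤ k := by exact_mod_cast hk
  have hB : 0 < 12 + K := by linarith
  have hlk : (12 + K) * (k : ℝ) ^ 2 ≤ Real.log z := by
    rw [one_div, ← div_eq_inv_mul, le_div_iff₀ hB] at hkz
    linarith
  have hl12 : 12 * (k : ℝ) ^ 2 ≤ Real.log z := by nlinarith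
  have hl0 : 0 < Real.log z := by nlinarith
  have hz0 : 0 < z := by linarith
  have hlz : Real.log z ≤ z - 1 := Real.log_le_sub_one_of_pos hz0
  have hz3 : 3 ≤ z := by nlinarith
  have hzN : z ≤ ⌈z⌉₊ := Nat.le_ceil z
  have hN : 2 * H.card ≤ ⌈z⌉₊ := by
    have : (2 * k : ℝ) ≤ ⌈z⌉₊ := by nlinarith
    rw [hcard]
    exact_mod_cast this
  have hDabs : (1 : ℝ) ≤ |(D : ℝ)| := by
    exact_mod_cast Int.one_le_abs hD0
  have hlogD : 1 ≤ Real.log (3 * |(D : ℝ)|) := by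
    refine (one_le_log_natCast (n := 3) le_rfl).trans (Real.log_le_log (by norm_num) ?_)
    push_cast
    linarith
  have hloglogD : 0 ≤ Real.log (Real.log (3 * |(D : ℝ)|)) := Real.log_nonneg hlogD
  have hL0 : 0 ≤ L := by rw [hL]; positivity
  have hDz : Real.log (3 * |(D : ℝ)|) ≤ √z := by
    rw [← Real.log_le_log_iff (by linarith) (Real.sqrt_pos.2 hz0), Real.log_sqrt hz0.le]
    rw [one_div, ← div_eq_inv_mul, le_div_iff₀ hB, hL] at hLz
    nlinarith [mul_nonneg (sub_nonneg.2 hk1) hloglogD,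
      mul_nonneg hK0 (mul_nonneg (by linarith : (0 : ℝ) ≤ k) hloglogD)]
  obtain ⟨t, hS, ht⟩ := exists_log_singSeries_tail hA (hcard ▸ hk) hD0 hν hN
  have hW := WSel_eq_exp hA z
  have hM := hK z hz3
  rw [hcard] at ht hW
  set S := ∑ n ∈ Finset.range ⌈z⌉₊, logLocalFactor H n
  set E := ∑ n ∈ Finset.range ⌈z⌉₊, mertensWeight n
  set γ := Real.eulerMascheroniConstant
  have hsqrt : √z / z ≤ 2 / Real.log z := by
    have h1 := Real.log_le_self (Real.sqrt_nonneg z)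
    rw [Real.log_sqrt hz0.le] at h1
    rw [div_le_div_iff₀ hz0 hl0]
    nlinarith [Real.sq_sqrt hz0.le, Real.sqrt_nonneg z]
  have ht' : |t| ≤ 12 * (k : ℝ) ^ 2 / Real.log z := by
    calc |t| ≤ _ := ht
      _ ≤ 8 * (k : ℝ) ^ 2 / z + 2 * k * √z / z := by gcongr
      _ = 8 * (k : ℝ) ^ 2 / z + 2 * k * (√z / z) := by ring
      _ ≤ 8 * (k : ℝ) ^ 2 / Real.log z + 2 * k * (2 / Real.log z) := by
          gcongr
          linarith
      _ = (8 * (k : ℝ) ^ 2 + 4 * k) / Real.log z := by ring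
      _ ≤ _ := by gcongr; nlinarith
  set δ := -t - k * (E - Real.log (Real.log z) - γ) with hδ
  have hδ1 : |δ| ≤ (12 + K) * (k : ℝ) ^ 2 / Real.log z := by
    have h1 : |k * (E - Real.log (Real.log z) - γ)| ≤ K * (k : ℝ) ^ 2 / Real.log z := by
      rw [abs_mul, abs_of_nonneg (by linarith)]
      calc _ ≤ (k : ℝ) * (K / Real.log z) := by gcongr
        _ = K * k / Real.log z := by ring
        _ ≤ _ := by gcongr; nlinarith
    rw [add_mul, add_div]
    rw [hδ]
    rw [abs_le] at h1 ht' ⊢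
    constructor <;> linarith
  have hδ2 : |δ| ≤ 1 := hδ1.trans (by rw [div_le_one hl0]; exact hlk)
  have hexp := Real.abs_exp_sub_one_le hδ2
  set X := singSeries H * Real.exp (-(γ * k)) / Real.log z ^ k with hX
  have hX0 : 0 ≤ X := by rw [hX, hS]; positivity
  have hWX : WSel H z = X * Real.exp δ := by
    have hlogpow : Real.log z ^ k = Real.exp (k * Real.log (Real.log z)) := by
      rw [Real.exp_nat_mul, Real.exp_log hl0]
    rw [hX, hW, hS, hlogpow, ← Real.exp_add, ← Real.exp_sub, ← Real.exp_add, hδ]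
    congr 1
    ring
  have hfin : WSel H z - X = X * (Real.exp δ - 1) := by rw [hWX]; ring
  rw [hfin, abs_mul, abs_of_nonneg hX0]
  calc X * |Real.exp δ - 1| ≤ X * (2 * ((12 + K) * (k : ℝ) ^ 2 / Real.log z)) := by
        gcongr
        linarith
    _ ≤ X * (2 * ((12 + K) * (L + (k : ℝ) ^ 3) / Real.log z)) := by
        gcongr
        nlinarith [sq_nonneg (k : ℝ)]
    _ = _ := by rw [hX]; ring
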